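/- (One-step duality for Bernoulli q-TASEP.) Fix q ∈ (0,1), N ≥ 1, parameters a_1,…,a_N > 0 and β > 0. Let x⃗ = (x_1 > x_2 > ⋯ > x_N) ∈ ℤ^N and set gap_i = x_{i−1} − x_i − 1 for 2 ≤ i ≤ N. For b⃗ ∈ {0,1}^N define w(b⃗) = ∏_{i=1}^{N} π_i(b⃗), where π_1 = a_1β/(1+a_1β) if b_1 = 1 and π_1 = 1/(1+a_1β) if b_1 = 0; and for 2 ≤ i ≤ N: if b_{i−1} = 1 then π_i = a_iβ/(1+a_iβ) if b_i = 1 and π_i = 1/(1+a_iβ) if b_i = 0, while if b_{i−1} = 0 then π_i = (1−q^{gap_i}) a_iβ/(1+a_iβ) if b_i = 1 and π_i = (1+a_iβ q^{gap_i})/(1+a_iβ) if b_i = 0. Then for every y⃗ ∈ Y^N: ∑_{b⃗∈{0,1}^N} w(b⃗) · (A^{(a_1β)}_1 ⋯ A^{(a_Nβ)}_N H_{x⃗+b⃗})(y⃗) = (A^{(q a_1β)}_1 ⋯ A^{(q a_Nβ)}_N H_{x⃗})(y⃗), where in each composition the operator with index N is applied first. -/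

import Mathlib

/-- The q-Pochhammer symbol `(a;q)_n = ∏_{i=0}^{n-1} (1 - a q^i)`. -/
noncomputable def qPoch (q a : ℝ) (n : ℕ) : ℝ := ∏ i ∈ Finset.range n, (1 - a * q ^ i)

/-- The coefficients `C_a(y,s)`, with the convention `C_a(y,s) = 0` for `s < 0` or `s > y`. -/
noncomputable def Cco (q a : ℝ) (y : ℕ) (s : ℤ) : ℝ :=
  if 0 ≤ s ∧ s ≤ (y : ℤ) then
    (-a) ^ s.toNat * qPoch q (-a) (y - s.toNat) *
      (qPoch q q y / (qPoch q q (y - s.toNat) * qPoch q q s.toNat))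
  else 0

/-- `y⃗^{s}_{i,i-1}`: move `s` units of mass from coordinate `i+1` (paper index `i+1 ∈ {1,…,N}`)
to coordinate `i` of `y⃗ ∈ Y^N = ℤ_{≥0}^{N+1}`.  Here `i : Fin N` denotes paper index `i+1`. -/
def moveY {N : ℕ} (y : Fin (N + 1) → ℕ) (i : Fin N) (s : ℕ) : Fin (N + 1) → ℕ :=
  Function.update (Function.update y i.succ (y i.succ - s)) i.castSucc (y i.castSucc + s)

/-- The operator `(A^{(a)}_i f)(y⃗) = ∑_{s=0}^{y_i} C_a(y_i,s) f(y⃗^{s}_{i,i-1})`,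
where `i : Fin N` denotes paper index `i+1`. -/
noncomputable def Aop {N : ℕ} (q a : ℝ) (i : Fin N) (f : (Fin (N + 1) → ℕ) → ℝ)
    (y : Fin (N + 1) → ℕ) : ℝ :=
  ∑ s ∈ Finset.range (y i.succ + 1), Cco q a (y i.succ) (s : ℤ) * f (moveY y i s)

/-- The composition `A^{(c_1)}_1 ⋯ A^{(c_N)}_N f`, with the operator of index `N` applied first. -/
noncomputable def Acomp {N : ℕ} (q : ℝ) (c : Fin N → ℝ) (f : (Fin (N + 1) → ℕ) → ℝ) :
    (Fin (N + 1) → ℕ) → ℝ :=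
  (List.finRange N).foldr (fun i g => Aop q (c i) i g) f

/-- `H_{x⃗}(y⃗) = ∏_{i=1}^{N} q^{(x_i+i) y_i}` if `y_0 = 0`, and `0` if `y_0 > 0`. -/
noncomputable def Hfun {N : ℕ} (q : ℝ) (x : Fin N → ℤ) (y : Fin (N + 1) → ℕ) : ℝ :=
  if y 0 = 0 then ∏ i : Fin N, q ^ ((x i + (i : ℕ) + 1) * (y i.succ : ℤ)) else 0

/-- Predecessor index in `Fin N` (truncated at `0`). -/
def predF {N : ℕ} (i : Fin N) : Fin N := ⟨(i : ℕ) - 1, Nat.lt_of_le_of_lt (Nat.sub_le _ _) i.isLt⟩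

/-- The one-step Bernoulli q-TASEP weight `π_i(b⃗)` of the update `b⃗ ∈ {0,1}^N` from
configuration `x⃗`; `i : Fin N` denotes paper particle `i+1` and `gap_i = x_{i-1} - x_i - 1`. -/
noncomputable def bernW {N : ℕ} (q : ℝ) (a : Fin N → ℝ) (β : ℝ) (x : Fin N → ℤ)
    (b : Fin N → Bool) (i : Fin N) : ℝ :=
  if (i : ℕ) = 0 then
    (if b i then a i * β / (1 + a i * β) else 1 / (1 + a i * β))
  else if b (predF i) then
    (if b i then a i * β / (1 + a i * β) else 1 / (1 + a i * β))
  else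
    (if b i then (1 - q ^ (x (predF i) - x i - 1).toNat) * (a i * β / (1 + a i * β))
     else (1 + a i * β * q ^ (x (predF i) - x i - 1).toNat) / (1 + a i * β))

open Finset in
/-- The homogeneous polynomial `∑ₛ C_c(y,s) uˢ v^{y-s}`. -/
noncomputable def homC (q c : ℝ) (y : ℕ) (u v : ℝ) : ℝ :=
  ∑ s ∈ range (y + 1), Cco q c y (s : ℤ) * (u ^ s * v ^ (y - s))

theorem qPoch_succ (q a : ℝ) (n : ℕ) :
    qPoch q a (n + 1) = qPoch q a n * (1 - a * q ^ n) := by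
  simp [qPoch, Finset.prod_range_succ]

theorem one_sub_mul_qPoch_mul (q a : ℝ) (n : ℕ) :
    (1 - a) * qPoch q (q * a) n = qPoch q a n * (1 - a * q ^ n) := by
  rw [← qPoch_succ, qPoch, qPoch, Finset.prod_range_succ', mul_comm]
  simp only [pow_zero, mul_one]
  congr 1
  exact Finset.prod_congr rfl fun i _ => by ring

theorem qPoch_self_ne_zero {q : ℝ} (hq : q ∈ Set.Ioo (0 : ℝ) 1) (n : ℕ) : qPoch q q n ≠ 0 := by
  refine Finset.prod_ne_zero_iff.2 fun i _ => ?_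
  rw [← pow_succ']
  exact (sub_pos.2 (pow_lt_one₀ hq.1.le hq.2 i.succ_ne_zero)).ne'

theorem Cco_add (q c : ℝ) (m s : ℕ) :
    Cco q c (s + m) (s : ℤ) =
      (-c) ^ s * qPoch q (-c) m * (qPoch q q (s + m) / (qPoch q q m * qPoch q q s)) := by
  simp [Cco]

theorem Cco_mul_one_add (q c : ℝ) (m s : ℕ) :
    (1 + c) * Cco q (q * c) (s + m) (s : ℤ) =
      q ^ s * (Cco q c (s + m) (s : ℤ) * (1 + c * q ^ m)) := by
  have h := one_sub_mul_qPoch_mul q (-c) m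
  rw [Cco_add, Cco_add, show -(q * c) = q * -c by ring, mul_pow]
  linear_combination
    q ^ s * (-c) ^ s * (qPoch q q (s + m) / (qPoch q q m * qPoch q q s)) * h

theorem Cco_succ_recurrence {q : ℝ} (hq : q ∈ Set.Ioo (0 : ℝ) 1) (c : ℝ) (m s : ℕ) :
    Cco q c (s + 1 + m) ((s + 1 : ℕ) : ℤ) * (1 + c * q ^ m)
        + c * Cco q c (s + 1 + m) (s : ℤ) * (1 - q ^ (m + 1))
      = (1 + c) * Cco q (q * c) (s + 1 + m) ((s + 1 : ℕ) : ℤ) := by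
  have hm := qPoch_self_ne_zero hq m
  have hm' := qPoch_self_ne_zero hq (m + 1)
  have hs := qPoch_self_ne_zero hq s
  have hs' := qPoch_self_ne_zero hq (s + 1)
  have h := Cco_add q c (m + 1) s
  rw [show s + (m + 1) = s + 1 + m by ring] at h
  rw [Cco_mul_one_add, h, Cco_add, qPoch_succ q (-c) m]
  rw [qPoch_succ] at hm' hs'
  rw [qPoch_succ q q s, qPoch_succ q q m]
  have e1 := (mul_ne_zero_iff.1 hm').2
  have e2 := (mul_ne_zero_iff.1 hs').2
  field_simp
  ring

theorem homC_step_of_moved (q c : ℝ) (y : ℕ) (u v : ℝ) :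
    homC q c y (q * u) v + c * homC q c y (q * u) (q * v) = (1 + c) * homC q (q * c) y u v := by
  simp only [homC, Finset.mul_sum, ← Finset.sum_add_distrib]
  refine Finset.sum_congr rfl fun s hs => ?_
  obtain ⟨m, rfl⟩ := Nat.exists_eq_add_of_le (Nat.lt_succ_iff.1 (Finset.mem_range.1 hs))
  rw [← mul_assoc (1 + c), Cco_mul_one_add, Nat.add_sub_cancel_left]
  ring

theorem homC_step_of_not_moved {q : ℝ} (hq : q ∈ Set.Ioo (0 : ℝ) 1) (c : ℝ) (y : ℕ) (z v : ℝ) :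
    (1 + c * z) * homC q c y (z * v) v + c * (1 - z) * homC q c y (z * v) (q * v)
      = (1 + c) * homC q (q * c) y (z * v) v := by
  have key : ∀ (d w : ℝ), homC q d y (z * v) (w * v) =
      v ^ y * ∑ s ∈ Finset.range (y + 1), Cco q d y (s : ℤ) * z ^ s * w ^ (y - s) := by
    intro d w
    rw [homC, Finset.mul_sum]
    refine Finset.sum_congr rfl fun s hs => ?_
    obtain ⟨m, rfl⟩ := Nat.exists_eq_add_of_le (Nat.lt_succ_iff.1 (Finset.mem_range.1 hs))
    rw [Nat.add_sub_cancel_left]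
    ring
  have key1 := fun d => key d 1
  simp only [one_mul, one_pow, mul_one] at key1
  rw [key1, key1, key]
  have h1 : ∑ s ∈ Finset.range (y + 1), Cco q c y (s : ℤ) * z ^ s * (1 + c * q ^ (y - s))
      + ∑ s ∈ Finset.range (y + 1), c * Cco q c y (s : ℤ) * z ^ (s + 1) * (1 - q ^ (y - s))
      = ∑ s ∈ Finset.range (y + 1), (1 + c) * Cco q (q * c) y (s : ℤ) * z ^ s := by
    rw [Finset.sum_range_succ', Finset.sum_range_succ _ y, Finset.sum_range_succ' _ y]
    have h0 := Cco_mul_one_add q c y 0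
    simp only [zero_add] at h0
    have h2 : ∑ s ∈ Finset.range y,
          Cco q c y ((s + 1 : ℕ) : ℤ) * z ^ (s + 1) * (1 + c * q ^ (y - (s + 1)))
        + ∑ s ∈ Finset.range y, c * Cco q c y (s : ℤ) * z ^ (s + 1) * (1 - q ^ (y - s))
        = ∑ s ∈ Finset.range y,
          (1 + c) * Cco q (q * c) y ((s + 1 : ℕ) : ℤ) * z ^ (s + 1) := by
      rw [← Finset.sum_add_distrib]
      refine Finset.sum_congr rfl fun s hs => ?_
      obtain ⟨m, rfl⟩ := Nat.exists_eq_add_of_le (Nat.succ_le_of_lt (Finset.mem_range.1 hs))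
      rw [show s.succ + m - (s + 1) = m by omega, show s.succ + m - s = m + 1 by omega]
      linear_combination z ^ (s + 1) * Cco_succ_recurrence hq c m s
    simp only [Nat.sub_self, Nat.sub_zero, pow_zero, mul_one]
    rw [h0, ← h2]
    ring
  have h3 : (1 + c) * ∑ s ∈ Finset.range (y + 1), Cco q (q * c) y (s : ℤ) * z ^ s
      = (1 + c * z) * (∑ s ∈ Finset.range (y + 1), Cco q c y (s : ℤ) * z ^ s)
        + c * (1 - z) *
          ∑ s ∈ Finset.range (y + 1), Cco q c y (s : ℤ) * z ^ s * q ^ (y - s) := by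
    simp only [mul_assoc, Finset.mul_sum] at h1 ⊢
    rw [← h1, ← Finset.sum_add_distrib, ← Finset.sum_add_distrib]
    exact Finset.sum_congr rfl fun s _ => by ring
  linear_combination -(v ^ y) * h3

theorem moveY_succ {N : ℕ} (k : ℕ) (y : Fin (N + 1) → ℕ) (i : Fin N) (s : ℕ) :
    moveY (Fin.cons k y : Fin (N + 2) → ℕ) i.succ s = Fin.cons k (moveY y i s) := by
  simp only [moveY, ← Fin.succ_castSucc, Fin.cons_succ, Fin.cons_update]

theorem foldr_Aop_map_succ {N : ℕ} (q : ℝ) (c : Fin (N + 1) → ℝ)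
    (f : (Fin (N + 2) → ℕ) → ℝ) (L : List (Fin N)) (k : ℕ) (y : Fin (N + 1) → ℕ) :
    (L.map Fin.succ).foldr (fun i g => Aop q (c i) i g) f (Fin.cons k y)
      = L.foldr (fun i g => Aop q (c i.succ) i g) (fun y' => f (Fin.cons k y')) y := by
  induction L generalizing y with
  | nil => rfl
  | cons i L ih =>
    simp only [List.map_cons, List.foldr_cons, Aop, Fin.cons_succ]
    exact Finset.sum_congr rfl fun s _ => by rw [moveY_succ, ih]

theorem Acomp_prod_pow {N : ℕ} (q : ℝ) (c : Fin N → ℝ) (u : Fin (N + 1) → ℝ) (k : ℝ)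
    (y : Fin (N + 1) → ℕ) :
    Acomp q c (fun y => k * ∏ i, u i ^ y i) y
      = k * u 0 ^ y 0 * ∏ i : Fin N, homC q (c i) (y i.succ) (u i.castSucc) (u i.succ) := by
  induction N generalizing k with
  | zero => simp [Acomp]
  | succ N ih =>
    have hmove : ∀ s, moveY y 0 s =
        Fin.cons (y 0 + s) (Function.update (Fin.tail y) 0 (y (Fin.succ 0) - s)) := by
      intro s
      funext j
      refine Fin.cases ?_ (fun j => ?_) j
      · simp [moveY]
      · refine Fin.cases ?_ (fun j => ?_) j
        · simp [moveY]
        · have h : j.succ.succ ≠ 1 := fun h => j.succ_ne_zero (Fin.succ_injective _ h)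
          simp [moveY, Fin.tail, h]
    have hrec : ∀ s, (List.foldr (fun i g => Aop q (c i) i g)
        (fun y => k * ∏ i, u i ^ y i) ((List.finRange N).map Fin.succ)) (moveY y 0 s)
        = k * u 0 ^ (y 0 + s) * u (Fin.succ 0) ^ (y (Fin.succ 0) - s) *
          ∏ i : Fin N, homC q (c i.succ) (y i.succ.succ) (u i.succ.castSucc) (u i.succ.succ) := by
      intro s
      rw [hmove, foldr_Aop_map_succ]
      simp only [Fin.prod_univ_succ (n := N + 1), Fin.cons_zero, Fin.cons_succ, ← mul_assoc]
      have := ih (fun i => c i.succ) (fun i => u i.succ) (k * u 0 ^ (y 0 + s))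
        (Function.update (Fin.tail y) 0 (y (Fin.succ 0) - s))
      rw [Acomp] at this
      rw [this]
      simp [Fin.tail]
    rw [Acomp, List.finRange_succ, List.foldr_cons, Aop]
    simp only [hrec]
    rw [Fin.prod_univ_succ, homC]
    simp only [Finset.mul_sum, Finset.sum_mul]
    refine Finset.sum_congr rfl fun s _ => ?_
    rw [Fin.castSucc_zero, pow_add]
    ring

theorem Hfun_eq_prod {N : ℕ} {q : ℝ} (x : Fin N → ℤ) :
    Hfun q x = fun y => 1 * ∏ i : Fin (N + 1),
      (Fin.cons 0 (fun i : Fin N => q ^ (x i + (i : ℕ) + 1)) : Fin (N + 1) → ℝ) i ^ y i := by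
  funext y
  rw [Hfun, Fin.prod_univ_succ]
  by_cases h : y 0 = 0 <;> simp [h, zpow_mul]

theorem Acomp_Hfun {N : ℕ} (q : ℝ) (c : Fin N → ℝ) (x : Fin N → ℤ) (y : Fin (N + 1) → ℕ) :
    Acomp q c (Hfun q x) y = 0 ^ y 0 * ∏ i : Fin N, homC q (c i) (y i.succ)
      ((Fin.cons 0 (fun i : Fin N => q ^ (x i + (i : ℕ) + 1)) : Fin (N + 1) → ℝ) i.castSucc)
      (q ^ (x i + (i : ℕ) + 1)) := by
  rw [Hfun_eq_prod, Acomp_prod_pow]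
  simp

/-- Summing a product of Markov-type kernels along a path, from the last step backwards. -/
theorem sum_prod_kernel {N : ℕ} (K : Fin N → Bool → Bool → ℝ) (r : Fin N → ℝ)
    (hK : ∀ i p, ∑ b, K i p b = r i) (p : Bool) :
    ∑ b : Fin N → Bool, ∏ i, K i ((Fin.cons p b : Fin (N + 1) → Bool) i.castSucc) (b i)
      = ∏ i, r i := by
  induction N generalizing p with
  | zero => simp
  | succ N ih =>
    rw [← (Fin.consEquiv fun _ => Bool).sum_comp, Fintype.sum_prod_type, Fin.prod_univ_succ,
      ← hK 0 p, Finset.sum_mul]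
    refine Finset.sum_congr rfl fun b₀ _ => ?_
    rw [← ih (fun i => K i.succ) (fun i => r i.succ) (fun i => hK i.succ) b₀, Finset.mul_sum]
    refine Finset.sum_congr rfl fun b _ => ?_
    simp [Fin.prod_univ_succ, Fin.consEquiv]

/-- The weight of a single particle update, where `p` says whether the preceding particle moved
and `z` is `q` to the power of the gap. -/
noncomputable def stepW (c z : ℝ) (p b : Bool) : ℝ :=
  if p then (if b then c / (1 + c) else 1 / (1 + c))
  else (if b then (1 - z) * (c / (1 + c)) else (1 + c * z) / (1 + c))

theorem sum_stepW_mul_homC {q : ℝ} (hq : q ∈ Set.Ioo (0 : ℝ) 1) {c : ℝ} (hc : 0 < c) (y : ℕ)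
    (z v : ℝ) (p : Bool) :
    ∑ b : Bool, stepW c z p b *
        homC q c y ((if p then q else 1) * (z * v)) ((if b then q else 1) * v)
      = homC q (q * c) y (z * v) v := by
  have h : 1 + c ≠ 0 := by positivity
  cases p
  · have := homC_step_of_not_moved hq c y z v
    simp only [Fintype.sum_bool, stepW, if_true, Bool.false_eq_true, if_false, one_mul]
    rw [← mul_right_inj' h, ← this]
    generalize homC q c y _ _ = A
    generalize homC q c y _ _ = B
    field_simp
    ring
  · have := homC_step_of_moved q c y (z * v) v
    simp only [Fintype.sum_bool, stepW, if_true, Bool.false_eq_true, if_false, one_mul]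
    rw [← mul_right_inj' h, ← this]
    generalize homC q c y _ _ = A
    generalize homC q c y _ _ = B
    field_simp
    ring

theorem stmt_6 (q : ℝ) (hq : q ∈ Set.Ioo (0:ℝ) 1) (N : ℕ) (hN : 1 ≤ N)
    (a : Fin N → ℝ) (ha : ∀ i, 0 < a i) (β : ℝ) (hβ : 0 < β)
    (x : Fin N → ℤ) (hx : StrictAnti x) (y : Fin (N + 1) → ℕ) :
    ∑ b : Fin N → Bool,
        (∏ i : Fin N, bernW q a β x b i)
          * Acomp q (fun i => a i * β)
              (Hfun q (fun i => x i + if b i then 1 else 0)) y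
      = Acomp q (fun i => q * (a i * β)) (Hfun q x) y := by
  obtain ⟨n, rfl⟩ := Nat.exists_eq_add_of_le' hN
  have hq0 : q ≠ 0 := hq.1.ne'
  let z : Fin (n + 1) → ℝ := Fin.cons 0 fun j => q ^ (x j.castSucc - x j.succ - 1).toNat
  let v : Fin (n + 1) → ℝ := fun i => q ^ (x i + (i : ℕ) + 1)
  have hzv : ∀ i, (Fin.cons 0 v : Fin (n + 2) → ℝ) i.castSucc = z i * v i := by
    refine Fin.cases (by simp [z]) fun j => ?_
    have hj : x j.succ < x j.castSucc := hx (Fin.castSucc_lt_succ)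
    simp only [← Fin.succ_castSucc, Fin.cons_succ, z, v]
    rw [← zpow_natCast, Int.toNat_of_nonneg (by omega), ← zpow_add₀ hq0]
    congr 1
    simp only [Fin.val_castSucc, Fin.val_succ]
    push_cast
    ring
  have hshift : ∀ (t : Bool) (k m : ℤ),
      q ^ (k + (if t then 1 else 0) + m + 1) = (if t then q else 1) * q ^ (k + m + 1) := by
    intro t k m
    cases t
    · simp
    · rw [if_pos rfl, if_pos rfl, ← zpow_one_add₀ hq0]
      congr 1
      ring
  let K : Fin (n + 1) → Bool → Bool → ℝ := fun i p b => stepW (a i * β) (z i) p b *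
    homC q (a i * β) (y i.succ) ((if p then q else 1) * (z i * v i)) ((if b then q else 1) * v i)
  have hsum := sum_prod_kernel K (fun i => homC q (q * (a i * β)) (y i.succ) (z i * v i) (v i))
    (fun i p => sum_stepW_mul_homC hq (mul_pos (ha i) hβ) _ _ _ p) true
  simp only [Acomp_Hfun]
  change _ = 0 ^ y 0 * ∏ i, homC q (q * (a i * β)) (y i.succ)
    ((Fin.cons 0 v : Fin (n + 2) → ℝ) i.castSucc) (v i)
  simp only [hzv]
  rw [← hsum, Finset.mul_sum]
  refine Finset.sum_congr rfl fun b _ => ?_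
  rw [mul_left_comm, ← Finset.prod_mul_distrib]
  congr 1
  refine Finset.prod_congr rfl fun i _ => ?_
  simp only [hshift]
  refine Fin.cases ?_ (fun j => ?_) i
  · simp [K, z, v, bernW, stepW]
  · have hp : predF j.succ = j.castSucc := by ext; simp [predF]
    have := hzv j.succ
    simp only [← Fin.succ_castSucc, Fin.cons_succ] at this
    simp only [← Fin.succ_castSucc, Fin.cons_succ, K, ← this]
    simp [z, v, bernW, stepW, hp]
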